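/- Let n ∈ ℕ and L, C, R ∈ ℝ_max^{n×n}. The system (8) is weakly consistent but not consistent if and only if, for all k ∈ ℕ₀, every entry of Π_k lies in ℝ_max (no entry equals +∞) and Π_{k+1} ≠ Π_k. -/

import Mathlib

noncomputable section

open scoped Classical

/-- Max-plus matrix-vector product: `(A ⊗ x)_i = sup_j (A_{ij} + x_j)`. -/
def mpMulVec {N P : Type*} (A : N → P → EReal) (x : P → EReal) : N → EReal :=
  fun i => ⨆ j, A i j + x j

/-- Max-plus matrix-matrix product. -/
def mpMulMat {N P Q : Type*} (A : N → P → EReal) (B : P → Q → EReal) : N → Q → EReal :=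
  fun i j => ⨆ k, A i k + B k j

/-- Max-plus identity matrix `E`. -/
def mpId {N : Type*} [DecidableEq N] : N → N → EReal :=
  fun i j => if i = j then (0 : EReal) else ⊥

/-- Max-plus matrix powers: `A^0 = E`, `A^{k+1} = A^k ⊗ A`. -/
def mpPow {N : Type*} [DecidableEq N] (A : N → N → EReal) : ℕ → N → N → EReal
  | 0 => mpId
  | k + 1 => mpMulMat (mpPow A k) A

/-- Kleene star `A* = sup_{k ≥ 0} A^k` (entrywise supremum). -/
def mpStar {N : Type*} [DecidableEq N] (A : N → N → EReal) : N → N → EReal :=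
  fun i j => ⨆ k : ℕ, mpPow A k i j

/-- Image of a matrix: `Im U = { U ⊗ u : u ∈ ℝ_max^P } ⊆ ℝ_max^N`. -/
def mpIm {N P : Type*} (U : N → P → EReal) : Set (N → EReal) :=
  { x | (∀ i, x i ≠ ⊤) ∧ ∃ u : P → EReal, (∀ j, u j ≠ ⊤) ∧ x = mpMulVec U u }

/-- Existence of a positive-weight circuit in the precedence graph `G(A)`. -/
def hasPosCircuit {N : Type*} (A : N → N → EReal) : Prop :=
  ∃ (l : ℕ) (p : ℕ → N), p l = p 0 ∧ (∀ t < l, A (p (t + 1)) (p t) ≠ ⊥) ∧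
    0 < ∑ t ∈ Finset.range l, A (p (t + 1)) (p t)

/-- The block-tridiagonal matrix `M_[K]` with diagonal blocks `C`,
superdiagonal blocks `L`, subdiagonal blocks `R`. -/
def MK {n : ℕ} (L C R : Fin n → Fin n → EReal) (K : ℕ) :
    Fin K × Fin n → Fin K × Fin n → EReal :=
  fun p q =>
    if p.1.val = q.1.val then C p.2 q.2
    else if p.1.val + 1 = q.1.val then L p.2 q.2
    else if q.1.val + 1 = p.1.val then R p.2 q.2
    else ⊥

/-- The infinite block-tridiagonal matrix `M_[∞]`, indexed by `ℕ × Fin n`. -/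
def Minf {n : ℕ} (L C R : Fin n → Fin n → EReal) :
    ℕ × Fin n → ℕ × Fin n → EReal :=
  fun p q =>
    if p.1 = q.1 then C p.2 q.2
    else if p.1 + 1 = q.1 then L p.2 q.2
    else if q.1 + 1 = p.1 then R p.2 q.2
    else ⊥

/-- Existence of a finite real trajectory `x : {1,…,K} → ℝ^n` satisfying
`x(k) ≥ C ⊗ x(k)`, `x(k) ≥ L ⊗ x(k+1)` and `x(k+1) ≥ R ⊗ x(k)`. -/
def FiniteTraj {n : ℕ} (L C R : Fin n → Fin n → EReal) (K : ℕ) : Prop :=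
  ∃ x : Fin K → Fin n → ℝ,
    (∀ k : Fin K, ∀ i, mpMulVec C (fun j => (x k j : EReal)) i ≤ (x k i : EReal)) ∧
    (∀ k : Fin K, ∀ h : k.val + 1 < K, ∀ i,
      mpMulVec L (fun j => (x ⟨k.val + 1, h⟩ j : EReal)) i ≤ (x k i : EReal) ∧
      mpMulVec R (fun j => (x k j : EReal)) i ≤ (x ⟨k.val + 1, h⟩ i : EReal))

/-- Weak consistency of system (8). -/
def WeaklyConsistent {n : ℕ} (L C R : Fin n → Fin n → EReal) : Prop :=
  ∀ K : ℕ, FiniteTraj L C R K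

/-- Consistency of system (8): existence of an infinite real trajectory. -/
def Consistent {n : ℕ} (L C R : Fin n → Fin n → EReal) : Prop :=
  ∃ x : ℕ → Fin n → ℝ, ∀ k : ℕ,
    (∀ i, mpMulVec L (fun j => (x (k + 1) j : EReal)) i ≤ (x k i : EReal)) ∧
    (∀ i, mpMulVec C (fun j => (x k j : EReal)) i ≤ (x k i : EReal)) ∧
    (∀ i, mpMulVec R (fun j => (x k j : EReal)) i ≤ (x (k + 1) i : EReal))

/-- The sequence `Π_0 = C*`, `Π_{k+1} = (L ⊗ Π_k ⊗ R ⊕ C)*`. -/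
def PiSeq {n : ℕ} (L C R : Fin n → Fin n → EReal) : ℕ → Fin n → Fin n → EReal
  | 0 => mpStar C
  | k + 1 => mpStar (fun i j => max (mpMulMat (mpMulMat L (PiSeq L C R k)) R i j) (C i j))

/-- Lifted matrix `Ā = [[ε, E], [ε, ε]]`. -/
def Abar (n : ℕ) : Fin n ⊕ Fin n → Fin n ⊕ Fin n → EReal :=
  fun p q =>
    match p, q with
    | Sum.inl i, Sum.inr j => mpId i j
    | _, _ => ⊥

/-- Lifted matrix `B̄ = [ε; E]`. -/
def Bbar (n : ℕ) : Fin n ⊕ Fin n → Fin n → EReal :=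
  fun p j =>
    match p with
    | Sum.inl _ => ⊥
    | Sum.inr i => mpId i j

/-- Lifted matrix `H = [[C, L], [R, C]]`. -/
def Hmat {n : ℕ} (L C R : Fin n → Fin n → EReal) :
    Fin n ⊕ Fin n → Fin n ⊕ Fin n → EReal :=
  fun p q =>
    match p, q with
    | Sum.inl i, Sum.inl j => C i j
    | Sum.inl i, Sum.inr j => L i j
    | Sum.inr i, Sum.inl j => R i j
    | Sum.inr i, Sum.inr j => C i j

/-- The semimodule `K = Im H*`. -/
def Kset {n : ℕ} (L C R : Fin n → Fin n → EReal) : Set (Fin n ⊕ Fin n → EReal) :=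
  mpIm (mpStar (Hmat L C R))

/-- The map `φ(X) = X ∩ { x ∈ ℝ_max^N : ∃ u ∈ ℝ_max^M, A ⊗ x ⊕ B ⊗ u ∈ X }`. -/
def mpPhi {N M : Type*} (A : N → N → EReal) (B : N → M → EReal)
    (X : Set (N → EReal)) : Set (N → EReal) :=
  X ∩ { x | (∀ i, x i ≠ ⊤) ∧ ∃ u : M → EReal, (∀ j, u j ≠ ⊤) ∧
    (fun i => max (mpMulVec A x i) (mpMulVec B u i)) ∈ X }

/-- Controlled trajectory: `x(1) = x0`, `x(k+1) = A ⊗ x(k) ⊕ B ⊗ u(k)`. -/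
def mpTraj {N M : Type*} (A : N → N → EReal) (B : N → M → EReal)
    (x0 : N → EReal) (u : ℕ → M → EReal) : ℕ → N → EReal
  | 0 => x0
  | k + 1 => fun i => max (mpMulVec A (mpTraj A B x0 u k) i) (mpMulVec B (u k) i)

/-- `K^♯`: states of `K` from which some control keeps the whole trajectory in `K`. -/
def mpKsharp {N M : Type*} (A : N → N → EReal) (B : N → M → EReal)
    (K : Set (N → EReal)) : Set (N → EReal) :=
  { x | x ∈ K ∧ ∃ u : ℕ → M → EReal, (∀ k j, u k j ≠ ⊤) ∧
    ∀ k : ℕ, mpTraj A B x u k ∈ K }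

/-- Real vectors `ℝ^N` inside `ℝ̄^N`. -/
def RealVecs {N : Type*} : Set (N → EReal) := { x | ∀ i, x i ≠ ⊤ ∧ x i ≠ ⊥ }

/-- Semimodules of `ℝ_max^N`: closed under entrywise max and scalar addition. -/
def IsSemimodule {N : Type*} (X : Set (N → EReal)) : Prop :=
  (∀ x ∈ X, ∀ i, x i ≠ ⊤) ∧
  (∀ x ∈ X, ∀ y ∈ X, (fun i => max (x i) (y i)) ∈ X) ∧
  (∀ x ∈ X, ∀ lam : EReal, lam ≠ ⊤ → (fun i => lam + x i) ∈ X)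

/-- Embedding of the first two block indices into `Fin (k+2) × Fin n`. -/
def emb2 {n : ℕ} (k : ℕ) : Fin n ⊕ Fin n → Fin (k + 2) × Fin n
  | Sum.inl i => (⟨0, by omega⟩, i)
  | Sum.inr i => (⟨1, by omega⟩, i)

/-- `S_{k+2}`: top-left `2n × 2n` submatrix of `(M_[k+2])*`. -/
def Smat {n : ℕ} (L C R : Fin n → Fin n → EReal) (k : ℕ) :
    Fin n ⊕ Fin n → Fin n ⊕ Fin n → EReal :=
  fun p q => mpStar (MK L C R (k + 2)) (emb2 k p) (emb2 k q)

/-- Embedding of the first two block indices into `ℕ × Fin n`. -/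
def embInf {n : ℕ} : Fin n ⊕ Fin n → ℕ × Fin n
  | Sum.inl i => (0, i)
  | Sum.inr i => (1, i)

/-- `S_∞`: top-left `2n × 2n` submatrix of `(M_[∞])*`. -/
def Sinf {n : ℕ} (L C R : Fin n → Fin n → EReal) :
    Fin n ⊕ Fin n → Fin n ⊕ Fin n → EReal :=
  fun p q => mpStar (Minf L C R) (embInf p) (embInf q)

section Subsolution

variable {N : Type*}

/-- `x ≥ A ⊗ x`, written entrywise. -/
def IsSubsolution (A : N → N → EReal) (x : N → ℝ) : Prop :=
  ∀ i j, A i j + (x j : EReal) ≤ (x i : EReal)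

lemma IsSubsolution.mono {A B : N → N → EReal} {x : N → ℝ} (h : IsSubsolution B x)
    (hAB : ∀ i j, A i j ≤ B i j) : IsSubsolution A x :=
  fun i j => (add_le_add_left (hAB i j) _).trans (h i j)

lemma IsSubsolution.ne_top {A : N → N → EReal} {x : N → ℝ} (h : IsSubsolution A x) (i j : N) :
    A i j ≠ ⊤ := fun hA => by simpa [hA] using h i j

end Subsolution

section Star

variable {N : Type*} [DecidableEq N]

lemma EReal.iSup_add_le_of_forall {ι : Sort*} {f : ι → EReal} {a c : EReal}
    (h : ∀ i, f i + a ≤ c) : (⨆ i, f i) + a ≤ c := by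
  refine EReal.add_le_of_forall_lt fun x hx y hy => ?_
  obtain ⟨i, hi⟩ := lt_iSup_iff.1 hx
  exact (add_le_add hi.le hy.le).trans (h i)

lemma EReal.add_iSup_le_of_forall {ι : Sort*} {f : ι → EReal} {a c : EReal}
    (h : ∀ i, a + f i ≤ c) : a + (⨆ i, f i) ≤ c := by
  rw [add_comm]
  exact EReal.iSup_add_le_of_forall fun i => by rw [add_comm]; exact h i

lemma mpPow_le_mpStar (A : N → N → EReal) (k : ℕ) (i j : N) :
    mpPow A k i j ≤ mpStar A i j :=
  le_iSup (fun k => mpPow A k i j) k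

lemma zero_le_mpStar_self (A : N → N → EReal) (i : N) : 0 ≤ mpStar A i i := by
  simpa [mpPow, mpId] using mpPow_le_mpStar A 0 i i

lemma mpStar_add_le (A : N → N → EReal) (i k j : N) :
    mpStar A i k + A k j ≤ mpStar A i j :=
  EReal.iSup_add_le_of_forall fun l =>
    (le_iSup (fun k => mpPow A l i k + A k j) k).trans (mpPow_le_mpStar A (l + 1) i j)

lemma le_mpStar (A : N → N → EReal) (i j : N) : A i j ≤ mpStar A i j :=
  calc A i j = 0 + A i j := (zero_add _).symm
    _ ≤ mpStar A i i + A i j := by gcongr; exact zero_le_mpStar_self A i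
    _ ≤ mpStar A i j := mpStar_add_le A i i j

lemma mpStar_add_mpStar_le (A : N → N → EReal) (i k j : N) :
    mpStar A i k + mpStar A k j ≤ mpStar A i j := by
  refine EReal.add_iSup_le_of_forall fun l => ?_
  induction l generalizing j with
  | zero =>
    by_cases h : k = j
    · simp [mpPow, mpId, h]
    · simp [mpPow, mpId, h]
  | succ l ih =>
    refine EReal.add_iSup_le_of_forall fun v => ?_
    rw [← add_assoc]
    exact (add_le_add_left (ih v) _).trans (mpStar_add_le A i v j)

lemma add_mpStar_le (A : N → N → EReal) (i k j : N) :
    A i k + mpStar A k j ≤ mpStar A i j :=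
  (add_le_add_left (le_mpStar A i k) _).trans (mpStar_add_mpStar_le A i k j)

lemma mpStar_mono {A B : N → N → EReal} (h : ∀ i j, A i j ≤ B i j) (i j : N) :
    mpStar A i j ≤ mpStar B i j := by
  refine iSup_le fun l => ?_
  induction l generalizing j with
  | zero => exact mpPow_le_mpStar B 0 i j
  | succ l ih =>
    exact iSup_le fun v => (add_le_add (ih v) (h v j)).trans (mpStar_add_le B i v j)

lemma IsSubsolution.kleeneStar {A : N → N → EReal} {x : N → ℝ} (h : IsSubsolution A x) :
    IsSubsolution (mpStar A) x := by
  intro i j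
  refine EReal.iSup_add_le_of_forall fun l => ?_
  induction l generalizing j with
  | zero =>
    by_cases hij : i = j
    · simp [mpPow, mpId, hij]
    · simp [mpPow, mpId, hij]
  | succ l ih =>
    refine EReal.iSup_add_le_of_forall fun v => ?_
    rw [add_assoc]
    exact (add_le_add_right (h v j) _).trans (ih v)

/-- A walk of large weight for `A` uses an edge on which `A` exceeds `B`, as soon as the weight
is not reached by `B`. -/
lemma exists_improving_edge {A B : N → N → EReal} {t : EReal}
    {i j : N} (hB : mpStar B i j ≤ t) (hA : t < mpStar A i j) :
    ∃ u v, B u v < A u v ∧ t < mpStar A i u + (A u v + mpStar A v j) := by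
  have key : ∀ (l : ℕ) (v : N) (s : EReal), s ≤ mpStar A v j → s ≤ mpStar B v j →
      t < mpPow A l i v + s →
      ∃ u v, B u v < A u v ∧ t < mpStar A i u + (A u v + mpStar A v j) := by
    intro l
    induction l with
    | zero =>
      intro v s _ hsB ht
      by_cases h : i = v
      · subst h
        simp only [mpPow, mpId, if_true, zero_add] at ht
        exact absurd (ht.trans_le (hsB.trans hB)) (lt_irrefl _)
      · simp [mpPow, mpId, h] at ht
    | succ l ih =>
      intro v s hsA hsB ht
      have : ∃ w, t < (mpPow A l i w + A w v) + s := by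
        by_contra! hcon
        exact absurd ht (not_lt.2 (EReal.iSup_add_le_of_forall hcon))
      obtain ⟨w, hw⟩ := this
      rw [add_assoc] at hw
      by_cases hlt : B w v < A w v
      · exact ⟨w, v, hlt, hw.trans_le
          (add_le_add (mpPow_le_mpStar A l i w) (add_le_add_right hsA _))⟩
      · exact ih w _ ((add_le_add_right hsA _).trans (add_mpStar_le A w v j))
          ((add_le_add (not_lt.1 hlt) hsB).trans (add_mpStar_le B w v j)) hw
  obtain ⟨l, hl⟩ := lt_iSup_iff.1 hA
  exact key l j 0 (zero_le_mpStar_self A j) (zero_le_mpStar_self B j) (by simpa using hl)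

end Star

section Bounds

lemma exists_real_ge {ι : Type*} [Finite ι] (f : ι → EReal) (hf : ∀ i, f i ≠ ⊤) :
    ∃ r : ℝ, ∀ i, f i ≤ r := by
  obtain ⟨r, hr⟩ := (Set.finite_range fun i => (f i).toReal).bddAbove
  refine ⟨r, fun i => (EReal.le_coe_toReal (hf i)).trans ?_⟩
  exact_mod_cast hr ⟨i, rfl⟩

variable {N : Type*} [Fintype N] [DecidableEq N]

/-- The vector `A* ⊗ z`, as a real vector. -/
lemma exists_real_mpStar_mulVec [Nonempty N] {A : N → N → EReal} (hA : ∀ i j, mpStar A i j ≠ ⊤)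
    (z : N → EReal) (hz : ∀ i, z i ≠ ⊤) (hz' : ∀ i, z i ≠ ⊥) :
    ∃ y : N → ℝ, IsSubsolution A y ∧ (∀ i, z i ≤ y i) ∧
      ∀ i, ∃ j, (y i : EReal) = mpStar A i j + z j := by
  have h : ∀ i, ∃ r : ℝ, (r : EReal) = ⨆ j, mpStar A i j + z j ∧
      ∃ j, (r : EReal) = mpStar A i j + z j := by
    intro i
    obtain ⟨j, hj⟩ := exists_eq_ciSup_of_finite (f := fun j => mpStar A i j + z j)
    have hle : z i ≤ ⨆ j, mpStar A i j + z j := by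
      refine le_trans ?_ (le_iSup (fun j => mpStar A i j + z j) i)
      calc z i = 0 + z i := (zero_add _).symm
        _ ≤ _ := by gcongr; exact zero_le_mpStar_self A i
    have htop : (⨆ j, mpStar A i j + z j) ≠ ⊤ := by
      rw [← hj]; exact EReal.add_ne_top (hA i j) (hz j)
    have hbot : (⨆ j, mpStar A i j + z j) ≠ ⊥ := fun hb =>
      hz' i (le_bot_iff.1 (hb ▸ hle))
    refine ⟨_, EReal.coe_toReal htop hbot, j, ?_⟩
    rw [EReal.coe_toReal htop hbot, hj]
  choose y hy hy' using h
  refine ⟨y, fun i j => ?_, fun i => ?_, hy'⟩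
  · obtain ⟨k, hk⟩ := hy' j
    rw [hk, hy, ← add_assoc]
    exact (add_le_add_left (add_mpStar_le A i j k) _).trans
      (le_iSup (fun j => mpStar A i j + z j) k)
  · rw [hy]
    refine le_trans ?_ (le_iSup (fun j => mpStar A i j + z j) i)
    calc z i = 0 + z i := (zero_add _).symm
      _ ≤ _ := by gcongr; exact zero_le_mpStar_self A i

lemma exists_isSubsolution {A : N → N → EReal} (hA : ∀ i j, mpStar A i j ≠ ⊤) :
    ∃ y : N → ℝ, IsSubsolution A y := by
  rcases isEmpty_or_nonempty N with h | h
  · exact ⟨fun _ => 0, fun i => h.elim i⟩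
  · obtain ⟨y, hy, -⟩ := exists_real_mpStar_mulVec hA (fun _ => 0) (by simp) (by simp)
    exact ⟨y, hy⟩

/-- Extension of a trajectory by one step. -/
lemma IsSubsolution.exists_next {L R A B : N → N → EReal}
    (hL : ∀ i j, L i j ≠ ⊤) (hR : ∀ i j, R i j ≠ ⊤)
    (hA : ∀ i j, mpStar A i j ≠ ⊤)
    (hB : ∀ i a b j, L i a + mpStar A a b + R b j ≤ B i j)
    {x : N → ℝ} (hx : IsSubsolution B x) :
    ∃ y : N → ℝ, IsSubsolution A y ∧ (∀ i j, L i j + (y j : EReal) ≤ x i) ∧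
      ∀ i j, R i j + (x j : EReal) ≤ y i := by
  rcases isEmpty_or_nonempty N with h | h
  · exact ⟨fun _ => 0, fun i => h.elim i, fun i => h.elim i, fun i => h.elim i⟩
  obtain ⟨M, hM⟩ := exists_real_ge
    (fun p : N × N × N => L p.1 p.2.1 + mpStar A p.2.1 p.2.2 + ((-x p.1 : ℝ) : EReal))
    fun p => EReal.add_ne_top (EReal.add_ne_top (hL _ _) (hA _ _)) (EReal.coe_ne_top _)
  obtain ⟨y, hy, hzy, hyz⟩ := exists_real_mpStar_mulVec hA
    (fun b => max (⨆ j, R b j + (x j : EReal)) ((-M : ℝ) : EReal))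
    (fun b => by
      obtain ⟨j, hj⟩ := exists_eq_ciSup_of_finite (f := fun j => R b j + (x j : EReal))
      rw [← hj]
      exact (max_lt (EReal.add_lt_top (hR _ _) (EReal.coe_ne_top _)) (EReal.coe_lt_top _)).ne)
    (fun b => ((EReal.bot_lt_coe _).trans_le (le_max_right _ _)).ne')
  refine ⟨y, hy, fun i a => ?_, fun i j => ?_⟩
  · obtain ⟨b, hb⟩ := hyz a
    rw [hb, ← add_assoc]
    rcases max_choice (⨆ j, R b j + (x j : EReal)) ((-M : ℝ) : EReal) with h | h <;> rw [h]
    · refine EReal.add_iSup_le_of_forall fun j => ?_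
      rw [← add_assoc]
      exact (add_le_add_left (hB i a b j) _).trans (hx i j)
    · have := hM (i, a, b)
      calc L i a + mpStar A a b + ((-M : ℝ) : EReal)
          = L i a + mpStar A a b + ((-x i : ℝ) : EReal) + ((x i - M : ℝ) : EReal) := by
            rw [add_assoc _ ((-x i : ℝ) : EReal), ← EReal.coe_add]; congr 2; ring
        _ ≤ (M : EReal) + ((x i - M : ℝ) : EReal) := by gcongr
        _ = x i := by rw [← EReal.coe_add]; congr 1; ring
  · exact (le_iSup (fun j => R i j + (x j : EReal)) j).trans ((le_max_left _ _).trans (hzy i))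

end Bounds

section PiSeq

variable {n : ℕ} {L C R : Fin n → Fin n → EReal}

/-- The matrix whose Kleene star is `Π_k`. -/
def piPre (L C R : Fin n → Fin n → EReal) : ℕ → Fin n → Fin n → EReal
  | 0 => C
  | k + 1 => fun i j => max (mpMulMat (mpMulMat L (PiSeq L C R k)) R i j) (C i j)

lemma PiSeq_eq_mpStar (k : ℕ) : PiSeq L C R k = mpStar (piPre L C R k) := by
  cases k <;> rfl

lemma C_le_piPre (k : ℕ) (i j : Fin n) : C i j ≤ piPre L C R k i j := by
  cases k
  · exact le_rfl
  · exact le_max_right _ _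

lemma add_add_le_piPre_succ (k : ℕ) (i a b j : Fin n) :
    L i a + PiSeq L C R k a b + R b j ≤ piPre L C R (k + 1) i j := by
  refine le_trans ?_ (le_max_left _ _)
  refine le_trans ?_ (le_iSup (fun b => mpMulMat L (PiSeq L C R k) i b + R b j) b)
  gcongr
  exact le_iSup (fun a => L i a + PiSeq L C R k a b) a

lemma piPre_succ_le {k : ℕ} {i j : Fin n} {c : EReal}
    (h : ∀ a b, L i a + PiSeq L C R k a b + R b j ≤ c) (hc : C i j ≤ c) :
    piPre L C R (k + 1) i j ≤ c :=
  max_le (iSup_le fun b => EReal.iSup_add_le_of_forall fun a => h a b) hc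

lemma piPre_le_succ (k : ℕ) (i j : Fin n) : piPre L C R k i j ≤ piPre L C R (k + 1) i j := by
  induction k generalizing i j with
  | zero => exact C_le_piPre 1 i j
  | succ k ih =>
    refine piPre_succ_le (fun a b => ?_) (C_le_piPre _ i j)
    refine le_trans ?_ (add_add_le_piPre_succ (k + 1) i a b j)
    rw [PiSeq_eq_mpStar, PiSeq_eq_mpStar]
    gcongr
    exact mpStar_mono ih a b

lemma monotone_piPre (i j : Fin n) : Monotone fun k => piPre L C R k i j :=
  monotone_nat_of_le_succ fun k => piPre_le_succ k i j

lemma monotone_PiSeq (i j : Fin n) : Monotone fun k => PiSeq L C R k i j := by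
  intro k l h
  simp only [PiSeq_eq_mpStar]
  exact mpStar_mono (fun a b => monotone_piPre a b h) i j

lemma IsSubsolution.piPre_succ {k : ℕ} {x y : Fin n → ℝ} (hC : IsSubsolution C x)
    (hL : ∀ i j, L i j + (y j : EReal) ≤ x i) (hR : ∀ i j, R i j + (x j : EReal) ≤ y i)
    (hy : IsSubsolution (PiSeq L C R k) y) : IsSubsolution (piPre L C R (k + 1)) x := by
  have h : ∀ i a b j, L i a + PiSeq L C R k a b + R b j + (x j : EReal) ≤ x i := by
    intro i a b j
    calc L i a + PiSeq L C R k a b + R b j + (x j : EReal)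
        = L i a + (PiSeq L C R k a b + (R b j + (x j : EReal))) := by simp only [add_assoc]
      _ ≤ L i a + (PiSeq L C R k a b + y b) := by gcongr; exact hR b j
      _ ≤ L i a + y a := by gcongr; exact hy a b
      _ ≤ x i := hL i a
  intro i j
  rw [← EReal.le_sub_iff_add_le (by simp) (by simp)]
  refine piPre_succ_le (fun a b => ?_) ?_ <;> rw [EReal.le_sub_iff_add_le (by simp) (by simp)]
  · exact h i a b j
  · exact hC i j

lemma isSubsolution_PiSeq {K : ℕ} {x : ℕ → Fin n → ℝ}
    (hC : ∀ k ≤ K, IsSubsolution C (x k))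
    (hL : ∀ k < K, ∀ i j, L i j + (x (k + 1) j : EReal) ≤ x k i)
    (hR : ∀ k < K, ∀ i j, R i j + (x k j : EReal) ≤ x (k + 1) i)
    (k b : ℕ) (hb : b + k ≤ K) : IsSubsolution (PiSeq L C R k) (x b) := by
  induction k generalizing b with
  | zero => exact (hC b hb).kleeneStar
  | succ k ih =>
    rw [PiSeq_eq_mpStar]
    exact ((hC b (by omega)).piPre_succ (hL b (by omega)) (hR b (by omega))
      (ih (b + 1) (by omega))).kleeneStar

lemma finiteTraj_succ_iff {K : ℕ} : FiniteTraj L C R (K + 1) ↔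
    ∃ x : ℕ → Fin n → ℝ, (∀ k ≤ K, IsSubsolution C (x k)) ∧
      (∀ k < K, ∀ i j, L i j + (x (k + 1) j : EReal) ≤ x k i) ∧
      ∀ k < K, ∀ i j, R i j + (x k j : EReal) ≤ x (k + 1) i := by
  simp only [FiniteTraj, mpMulVec, iSup_le_iff, IsSubsolution]
  constructor
  · rintro ⟨x, hC, hLR⟩
    have hx : ∀ k (hk : k ≤ K), x (Fin.ofNat (K + 1) k) = x ⟨k, Nat.lt_succ_of_le hk⟩ :=
      fun k hk => congrArg x (Fin.ext (Nat.mod_eq_of_lt (Nat.lt_succ_of_le hk)))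
    refine ⟨fun k => x (Fin.ofNat (K + 1) k), fun k hk => ?_, fun k hk i j => ?_,
      fun k hk i j => ?_⟩
    · exact hC (Fin.ofNat (K + 1) k)
    · beta_reduce
      rw [hx k (by omega), hx (k + 1) (by omega)]
      exact (hLR ⟨k, by omega⟩ (by simpa using hk) i).1 j
    · beta_reduce
      rw [hx k (by omega), hx (k + 1) (by omega)]
      exact (hLR ⟨k, by omega⟩ (by simpa using hk) i).2 j
  · rintro ⟨x, hC, hL, hR⟩
    exact ⟨fun k => x k, fun k => hC k (Nat.le_of_lt_succ k.isLt), fun k h i =>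
      ⟨hL k (Nat.succ_lt_succ_iff.1 h) i, hR k (Nat.succ_lt_succ_iff.1 h) i⟩⟩

lemma consistent_iff : Consistent L C R ↔
    ∃ x : ℕ → Fin n → ℝ, ∀ k, IsSubsolution C (x k) ∧
      (∀ i j, L i j + (x (k + 1) j : EReal) ≤ x k i) ∧
      ∀ i j, R i j + (x k j : EReal) ≤ x (k + 1) i := by
  simp only [Consistent, mpMulVec, iSup_le_iff, IsSubsolution]
  exact exists_congr fun x => forall_congr' fun k => by tauto

lemma WeaklyConsistent.PiSeq_ne_top (h : WeaklyConsistent L C R) (k : ℕ) (i j : Fin n) :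
    PiSeq L C R k i j ≠ ⊤ := by
  obtain ⟨x, hC, hL, hR⟩ := finiteTraj_succ_iff.1 (h (k + 1))
  exact (isSubsolution_PiSeq hC hL hR k 0 (by omega)).ne_top i j

lemma exists_trajectory_of_isSubsolution (hL : ∀ i j, L i j ≠ ⊤) (hR : ∀ i j, R i j ≠ ⊤)
    (h : ∀ k i j, PiSeq L C R k i j ≠ ⊤) (K : ℕ) (x₀ : Fin n → ℝ)
    (hx₀ : IsSubsolution (piPre L C R K) x₀) :
    ∃ x : ℕ → Fin n → ℝ, x 0 = x₀ ∧ (∀ k ≤ K, IsSubsolution C (x k)) ∧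
      (∀ k < K, ∀ i j, L i j + (x (k + 1) j : EReal) ≤ x k i) ∧
      ∀ k < K, ∀ i j, R i j + (x k j : EReal) ≤ x (k + 1) i := by
  induction K generalizing x₀ with
  | zero =>
    exact ⟨fun _ => x₀, rfl, fun _ _ => hx₀, fun k hk => by omega, fun k hk => by omega⟩
  | succ K ih =>
    obtain ⟨y, hy, hLy, hRy⟩ := hx₀.exists_next hL hR (A := piPre L C R K)
      (by simpa only [PiSeq_eq_mpStar] using h K)
      (by simpa only [PiSeq_eq_mpStar] using add_add_le_piPre_succ K)
    obtain ⟨x, rfl, hxC, hxL, hxR⟩ := ih y hy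
    refine ⟨fun k => Nat.casesOn k x₀ x, rfl, ?_, ?_, ?_⟩
    · rintro (_ | k) hk
      · exact hx₀.mono (C_le_piPre _)
      · exact hxC k (by omega)
    · rintro (_ | k) hk
      · exact hLy
      · exact hxL k (by omega)
    · rintro (_ | k) hk
      · exact hRy
      · exact hxR k (by omega)

lemma FiniteTraj.of_succ {K : ℕ} (h : FiniteTraj L C R (K + 1)) : FiniteTraj L C R K := by
  obtain ⟨x, hC, hLR⟩ := h
  exact ⟨fun k => x k.castSucc, fun k => hC k.castSucc,
    fun k hk => hLR k.castSucc (hk.trans (Nat.lt_succ_self K))⟩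

lemma weaklyConsistent_iff (hL : ∀ i j, L i j ≠ ⊤) (hR : ∀ i j, R i j ≠ ⊤) :
    WeaklyConsistent L C R ↔ ∀ k i j, PiSeq L C R k i j ≠ ⊤ := by
  refine ⟨fun h => h.PiSeq_ne_top, fun h K => FiniteTraj.of_succ ?_⟩
  obtain ⟨x₀, hx₀⟩ := exists_isSubsolution (A := piPre L C R K)
    (by simpa only [PiSeq_eq_mpStar] using h K)
  obtain ⟨x, -, hx⟩ := exists_trajectory_of_isSubsolution hL hR h K x₀ hx₀
  exact finiteTraj_succ_iff.2 ⟨x, hx⟩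

lemma consistent_of_PiSeq_succ_eq (hL : ∀ i j, L i j ≠ ⊤) (hR : ∀ i j, R i j ≠ ⊤)
    {k : ℕ} (h : ∀ i j, PiSeq L C R k i j ≠ ⊤) (hk : PiSeq L C R (k + 1) = PiSeq L C R k) :
    Consistent L C R := by
  have hA : ∀ i j, mpStar (piPre L C R (k + 1)) i j ≠ ⊤ := by
    rwa [← PiSeq_eq_mpStar, hk]
  have hB : ∀ i a b j, L i a + mpStar (piPre L C R (k + 1)) a b + R b j ≤
      piPre L C R (k + 1) i j := by
    rw [← PiSeq_eq_mpStar, hk]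
    exact add_add_le_piPre_succ k
  choose! next hnext using fun x (hx : IsSubsolution (piPre L C R (k + 1)) x) =>
    hx.exists_next hL hR hA hB
  obtain ⟨x₀, hx₀⟩ := exists_isSubsolution hA
  have hsub : ∀ m, IsSubsolution (piPre L C R (k + 1)) (next^[m] x₀) := by
    intro m
    induction m with
    | zero => exact hx₀
    | succ m ih => rw [Function.iterate_succ_apply']; exact (hnext _ ih).1
  refine consistent_iff.2 ⟨fun m => next^[m] x₀, fun m => ⟨(hsub m).mono (C_le_piPre _), ?_⟩⟩
  simp only [Function.iterate_succ_apply']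
  exact (hnext _ (hsub m)).2

lemma Consistent.exists_bound (h : Consistent L C R) :
    ∃ B : Fin n → Fin n → ℝ, ∀ k i j, PiSeq L C R k i j ≤ B i j := by
  obtain ⟨x, hx⟩ := consistent_iff.1 h
  refine ⟨fun i j => x 0 i - x 0 j, fun k i j => ?_⟩
  rw [EReal.coe_sub, EReal.le_sub_iff_add_le (by simp) (by simp)]
  exact isSubsolution_PiSeq (K := k) (fun k _ => (hx k).1) (fun k _ => (hx k).2.1)
    (fun k _ => (hx k).2.2) k 0 (by omega) i j

/-- An improvement of an entry of `Π` at level `k + 2` comes from an improvement of an entry at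
level `k + 1`, through a context of real weight `c` available at all later levels. -/
lemma exists_context (hL : ∀ i j, L i j ≠ ⊤) (hR : ∀ i j, R i j ≠ ⊤)
    (hfin : ∀ k i j, PiSeq L C R k i j ≠ ⊤) {k : ℕ} {i j : Fin n} {t : EReal}
    (hle : PiSeq L C R (k + 1) i j ≤ t) (hlt : t < PiSeq L C R (k + 2) i j) :
    ∃ (a b : Fin n) (c : ℝ),
      (∀ m ≥ k + 1, (c : EReal) + PiSeq L C R m a b ≤ PiSeq L C R (m + 1) i j) ∧
      PiSeq L C R k a b < PiSeq L C R (k + 1) a b ∧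
      t < (c : EReal) + PiSeq L C R (k + 1) a b := by
  have : Nonempty (Fin n) := ⟨i⟩
  rw [PiSeq_eq_mpStar] at hle hlt
  obtain ⟨u, v, huv, ht⟩ := exists_improving_edge hle hlt
  rw [← PiSeq_eq_mpStar] at ht
  obtain ⟨a, b, hab⟩ : ∃ a b, piPre L C R (k + 2) u v =
      L u a + PiSeq L C R (k + 1) a b + R b v := by
    obtain ⟨b, hb⟩ := exists_eq_ciSup_of_finite
      (f := fun b => mpMulMat L (PiSeq L C R (k + 1)) u b + R b v)
    obtain ⟨a, ha⟩ := exists_eq_ciSup_of_finite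
      (f := fun a => L u a + PiSeq L C R (k + 1) a b)
    refine ⟨a, b, ?_⟩
    rcases max_choice (mpMulMat (mpMulMat L (PiSeq L C R (k + 1))) R u v) (C u v) with h | h
    · exact h.trans (hb.symm.trans (by rw [ha]; rfl))
    · exact absurd (huv.trans_le (h.le.trans (C_le_piPre (k + 1) u v))) (lt_irrefl _)
  set w := PiSeq L C R (k + 2) i u + L u a + R b v + PiSeq L C R (k + 2) v j with hw
  have hsum : ∀ p x y z q : EReal, p + (x + y + z + q) = (p + x + z + q) + y := by
    intros; abel
  rw [hab, hsum, ← hw] at ht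
  have hwtop : w ≠ ⊤ := EReal.add_ne_top (EReal.add_ne_top (EReal.add_ne_top (hfin _ _ _)
    (hL _ _)) (hR _ _)) (hfin _ _ _)
  have hwbot : w ≠ ⊥ := (EReal.bot_lt_add_iff.1 (bot_le.trans_lt ht)).1.ne'
  have hc : (w.toReal : EReal) = w := EReal.coe_toReal hwtop hwbot
  refine ⟨a, b, w.toReal, fun m hm => ?_, lt_of_not_ge fun hcon => ?_, by rwa [hc]⟩
  · rw [hc, hw, ← hsum]
    have h2 : ∀ p q, PiSeq L C R (k + 2) p q ≤ PiSeq L C R (m + 1) p q :=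
      fun p q => monotone_PiSeq p q (by omega)
    refine (add_le_add (h2 i u) (add_le_add (add_add_le_piPre_succ m u a b v) (h2 v j))).trans ?_
    simp only [PiSeq_eq_mpStar (m + 1)]
    exact (add_le_add_right (add_mpStar_le _ _ _ _) _).trans (mpStar_add_mpStar_le _ _ _ _)
  · refine absurd (huv.trans_le ?_) (lt_irrefl (piPre L C R (k + 1) u v))
    rw [hab]
    exact (add_le_add_left (add_le_add_right hcon _) _).trans (add_add_le_piPre_succ k u a b v)

lemma not_forall_add_le {P : ℕ → EReal} {B d : ℝ} {m h : ℕ} (hB : ∀ k, P k ≤ B) (hd : 0 < d)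
    (hm : P m ≠ ⊥) : ¬ ∀ k ≥ m, (d : EReal) + P k ≤ P (k + h) := by
  intro hP
  obtain ⟨r, hr⟩ : ∃ r : ℝ, (r : EReal) = P m :=
    ⟨_, EReal.coe_toReal ((hB m).trans_lt (EReal.coe_lt_top B)).ne hm⟩
  have hpow : ∀ l : ℕ, ((l * d + r : ℝ) : EReal) ≤ P (m + l * h) := by
    intro l
    induction l with
    | zero => simp [hr]
    | succ l ih =>
      calc (((l + 1 : ℕ) * d + r : ℝ) : EReal) = (d : EReal) + ((l * d + r : ℝ) : EReal) := by
            rw [← EReal.coe_add]; congr 1; push_cast; ring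
        _ ≤ (d : EReal) + P (m + l * h) := by gcongr
        _ ≤ P (m + l * h + h) := hP _ (by omega)
        _ = P (m + (l + 1) * h) := by congr 1; ring
  obtain ⟨l, hl⟩ := Archimedean.arch (B - r + 1) hd
  have := EReal.coe_le_coe_iff.1 ((hpow l).trans (hB _))
  rw [nsmul_eq_mul] at hl
  linarith

/-- The entry `q` at level `k + 1` is nested in the entry `p` at level `k + 1 + h` with a context
of real weight `d`, and all values of `q` above `t` improve `p`. -/
def IsEnclosing (L C R : Fin n → Fin n → EReal) (k : ℕ) (t : EReal) (q p : Fin n × Fin n) : Prop :=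
  ∃ (d : ℝ) (h : ℕ), 1 ≤ h ∧
    (∀ m ≥ k + 1, (d : EReal) + PiSeq L C R m q.1 q.2 ≤ PiSeq L C R (m + h) p.1 p.2) ∧
    PiSeq L C R (k + h) p.1 p.2 ≤ (d : EReal) + t

lemma not_isEnclosing_self {B : ℝ} {k : ℕ} {t : EReal} {q : Fin n × Fin n}
    (hB : ∀ k, PiSeq L C R k q.1 q.2 ≤ B) (hlt : t < PiSeq L C R (k + 1) q.1 q.2) :
    ¬ IsEnclosing L C R k t q q := by
  rintro ⟨d, h, hh, hctx, hdt⟩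
  have hd : 0 < d := by
    by_contra! hd
    refine absurd hlt (not_lt.2 ?_)
    calc PiSeq L C R (k + 1) q.1 q.2 ≤ PiSeq L C R (k + h) q.1 q.2 :=
          monotone_PiSeq q.1 q.2 (by omega)
      _ ≤ (d : EReal) + t := hdt
      _ ≤ 0 + t := by gcongr; exact_mod_cast hd
      _ = t := zero_add t
  exact not_forall_add_le hB hd (bot_le.trans_lt hlt).ne' hctx

/-- Pigeonhole over nested improvements: `V` collects the enclosing entries. -/
lemma PiSeq_succ_le_of_isEnclosing (hL : ∀ i j, L i j ≠ ⊤) (hR : ∀ i j, R i j ≠ ⊤)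
    {B : Fin n → Fin n → ℝ} (hB : ∀ k i j, PiSeq L C R k i j ≤ B i j)
    (k : ℕ) (V : Finset (Fin n × Fin n)) (hcard : Fintype.card (Fin n × Fin n) ≤ V.card + k)
    (q : Fin n × Fin n) (t : EReal) (hV : ∀ p ∈ V, IsEnclosing L C R k t q p)
    (hle : PiSeq L C R k q.1 q.2 ≤ t) : PiSeq L C R (k + 1) q.1 q.2 ≤ t := by
  have hfin : ∀ k i j, PiSeq L C R k i j ≠ ⊤ :=
    fun k i j => ((hB k i j).trans_lt (EReal.coe_lt_top _)).ne
  induction k generalizing V q t with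
  | zero =>
    by_contra! hlt
    have : V = Finset.univ := Finset.eq_univ_of_card V
      (le_antisymm (Finset.card_le_univ V) (by simpa using hcard))
    exact not_isEnclosing_self (fun k => hB k _ _) hlt (hV q (this ▸ Finset.mem_univ _))
  | succ k ih =>
    by_contra! hlt
    have hmem : q ∉ V := fun hq => not_isEnclosing_self (fun k => hB k _ _) hlt (hV q hq)
    obtain ⟨a, b, c, hctx, himp, htc⟩ := exists_context hL hR hfin hle hlt
    have hcancel : (c : EReal) + (((-c : ℝ) : EReal) + t) = t := by
      rw [← add_assoc, ← EReal.coe_add]; simp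
    have ht : t ≤ (c : EReal) + max (((-c : ℝ) : EReal) + t) (PiSeq L C R k a b) :=
      hcancel.symm.le.trans (by gcongr; exact le_max_left _ _)
    refine absurd (ih (insert q V) ?_ (a, b) (max (((-c : ℝ) : EReal) + t) (PiSeq L C R k a b))
      ?_ (le_max_right _ _)) (not_le.2 (max_lt ?_ himp))
    · rw [Finset.card_insert_of_notMem hmem]; omega
    · intro p hp
      rcases Finset.mem_insert.1 hp with rfl | hp
      · exact ⟨c, 1, le_rfl, hctx, hle.trans ht⟩
      · obtain ⟨d, h, hh, hdctx, hdt⟩ := hV p hp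
        refine ⟨d + c, h + 1, by omega, fun m hm => ?_, ?_⟩
        · rw [EReal.coe_add, add_assoc, show m + (h + 1) = m + 1 + h by ring]
          exact (add_le_add_right (hctx m hm) _).trans (hdctx (m + 1) (by omega))
        · rw [EReal.coe_add, add_assoc, show k + (h + 1) = k + 1 + h by ring]
          exact hdt.trans (add_le_add_right ht _)
    · have := EReal.add_lt_add_left_coe htc (-c)
      rwa [← add_assoc, ← EReal.coe_add, neg_add_cancel, EReal.coe_zero, zero_add] at this

lemma Consistent.exists_PiSeq_succ_eq (hL : ∀ i j, L i j ≠ ⊤) (hR : ∀ i j, R i j ≠ ⊤)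
    (h : Consistent L C R) : ∃ k, PiSeq L C R (k + 1) = PiSeq L C R k := by
  obtain ⟨B, hB⟩ := h.exists_bound
  refine ⟨Fintype.card (Fin n × Fin n), funext₂ fun i j =>
    le_antisymm ?_ (monotone_PiSeq i j (Nat.le_succ _))⟩
  exact PiSeq_succ_le_of_isEnclosing hL hR hB _ ∅ (by simp) (i, j) _ (by simp) le_rfl

end PiSeq

/-- system (8) is weakly consistent but not consistent iff, for
all `k ∈ ℕ₀`, every entry of `Π_k` lies in `ℝ_max` and `Π_{k+1} ≠ Π_k`. -/
theorem stmt_9 (n : ℕ) (hn : 0 < n) (L C R : Fin n → Fin n → EReal)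
    (hL : ∀ i j, L i j ≠ ⊤) (hC : ∀ i j, C i j ≠ ⊤) (hR : ∀ i j, R i j ≠ ⊤) :
    (WeaklyConsistent L C R ∧ ¬ Consistent L C R) ↔
      ∀ k : ℕ, (∀ i j, PiSeq L C R k i j ≠ ⊤) ∧
        PiSeq L C R (k + 1) ≠ PiSeq L C R k := by

  rw [weaklyConsistent_iff hL hR]
  constructor
  · rintro ⟨hfin, hcons⟩ k
    exact ⟨hfin k, fun hk => hcons (consistent_of_PiSeq_succ_eq hL hR (hfin k) hk)⟩
  · refine fun h => ⟨fun k => (h k).1, fun hcons => ?_⟩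
    obtain ⟨k, hk⟩ := hcons.exists_PiSeq_succ_eq hL hR
    exact (h k).2 hk
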